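/- For every integer b ≥ 4 there is a constant C_b > 0, depending only on b, such that for all integers q ≥ 4 and M ≥ 4 and all real x ≥ e^e: |E_q(x) − D_q(x)| ≤ C_b·( ∑_{m=2}^{M−1} D_{mq}(x) + ∑_{m ≥ M} D*_{mq}(x; b) + M·x·(log log x)^{b−1}/log x ). -/

import Mathlib

noncomputable section

def IsInvFactorDecomp (G : Type*) [CommGroup G] {k : ℕ} (d : Fin k → ℕ) : Prop :=
  (∀ i, 1 < d i) ∧ (∀ i j : Fin k, i ≤ j → d i ∣ d j) ∧
    Nonempty (G ≃* ((i : Fin k) → Multiplicative (ZMod (d i))))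

/-- The least invariant factor of a (nontrivial) commutative group. -/
def leastInvFactor (G : Type*) [CommGroup G] : ℕ :=
  sInf {m | ∃ (k : ℕ) (d : Fin (k + 1) → ℕ), IsInvFactorDecomp G d ∧ d 0 = m}

/-- `λ₁(n)`: the least invariant factor of `(ℤ/nℤ)ˣ` for `n ≥ 3`, and `1` for `n = 1, 2`. -/
def lambda1 (n : ℕ) : ℕ := if n ≤ 2 then 1 else leastInvFactor (ZMod n)ˣ

/-- `E_q(x)`: the number of `n ≤ x` with `λ₁(n) = q`. -/
def Ecount (q : ℕ) (x : ℝ) : ℕ := {n : ℕ | 0 < n ∧ (n : ℝ) ≤ x ∧ lambda1 n = q}.ncard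

/-- `D_q(x)`: the number of `n ≤ x` with `q ∣ λ₁(n)`. -/
def Dcount (q : ℕ) (x : ℝ) : ℕ := {n : ℕ | 0 < n ∧ (n : ℝ) ≤ x ∧ q ∣ lambda1 n}.ncard

/-- `D*_q(x; b)`: the number of `n ≤ x` with `q ∣ λ₁(n)` and `ω(n) > b`. -/
def Dstar (q : ℕ) (x : ℝ) (b : ℕ) : ℕ :=
  {n : ℕ | 0 < n ∧ (n : ℝ) ≤ x ∧ q ∣ lambda1 n ∧ b < n.primeFactors.card}.ncard

open Finset

/-- A factor of a positive number `a` whose complement in `lcm a b` is coprime to it is a unitary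
divisor of `a`. -/
theorem coprime_cofactor_of_lcm_eq {a b L R c : ℕ} (ha : a ≠ 0) (hb : b ≠ 0)
    (hLR : L.Coprime R) (hlcm : L * R = Nat.lcm a b) (hac : a = L * c) : L.Coprime c := by
  have hl : Nat.lcm a b ≠ 0 := Nat.lcm_ne_zero ha hb
  have hL : L ≠ 0 := by rintro rfl; simp at hac; exact ha hac
  have hc : c ≠ 0 := by rintro rfl; simp at hac; exact ha hac
  have hR : R ≠ 0 := by rintro rfl; simp at hlcm; exact hl hlcm.symm
  refine Nat.Coprime.symm (Nat.coprime_of_dvd ?_)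
  intro p hp hpc hpL
  have hpR : ¬ p ∣ R := fun h => Nat.not_coprime_of_dvd_of_dvd hp.one_lt hpL h hLR
  have h1 : a.factorization p ≤ (Nat.lcm a b).factorization p :=
    (Nat.factorization_le_iff_dvd ha hl).2 (Nat.dvd_lcm_left a b) p
  rw [← hlcm, Nat.factorization_mul hL hR, hac, Nat.factorization_mul hL hc] at h1
  have h2 := Nat.factorization_eq_zero_of_not_dvd hpR
  have h3 := hp.factorization_pos_of_dvd hc hpc
  simp at h1
  omega

theorem nonempty_zmod_prod_addEquiv_gcd_lcm {a b : ℕ} (ha : a ≠ 0) (hb : b ≠ 0) :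
    Nonempty (ZMod a × ZMod b ≃+ ZMod (Nat.gcd a b) × ZMod (Nat.lcm a b)) := by
  set L := Nat.factorizationLCMLeft a b
  set R := Nat.factorizationLCMRight a b
  have hLR : L.Coprime R := Nat.coprime_factorizationLCMLeft_factorizationLCMRight a b
  have hlcm : L * R = Nat.lcm a b := Nat.factorizationLCMLeft_mul_factorizationLCMRight ha hb
  obtain ⟨c, hc⟩ : L ∣ a := Nat.factorizationLCMLeft_dvd_left a b
  obtain ⟨d, hd⟩ : R ∣ b := Nat.factorizationLCMRight_dvd_right a b
  have hLc : L.Coprime c := coprime_cofactor_of_lcm_eq ha hb hLR hlcm hc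
  have hRd : R.Coprime d := coprime_cofactor_of_lcm_eq hb ha hLR.symm
    (by rw [mul_comm, hlcm, Nat.lcm_comm]) hd
  have hgcd : Nat.gcd a b = c * d := by
    have h := Nat.gcd_mul_lcm a b
    refine Nat.eq_of_mul_eq_mul_right (Nat.pos_of_ne_zero (Nat.lcm_ne_zero ha hb)) ?_
    rw [h, ← hlcm]
    nth_rewrite 1 [hc, hd]
    ring
  have hcd : c.Coprime d := by
    refine Nat.coprime_of_dvd ?_
    intro p hp hpc hpd
    have h1 : p ∣ L * R := hlcm ▸ (hc ▸ hpc.mul_left L : p ∣ a).trans (Nat.dvd_lcm_left a b)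
    rcases hp.dvd_mul.1 h1 with h | h
    · exact Nat.not_coprime_of_dvd_of_dvd hp.one_lt h hpc hLc
    · exact Nat.not_coprime_of_dvd_of_dvd hp.one_lt h hpd hRd
  rw [hgcd, ← hlcm, hc, hd]
  exact ⟨((ZMod.chineseRemainder hLc).toAddEquiv.prodCongr
    (ZMod.chineseRemainder hRd).toAddEquiv).trans <| (AddEquiv.prodProdProdComm _ _ _ _).trans <|
    AddEquiv.prodComm.trans <| (ZMod.chineseRemainder hcd).toAddEquiv.symm.prodCongr
      (ZMod.chineseRemainder hLR).toAddEquiv.symm⟩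

/-- Splitting off the first coordinate, as an additive equivalence. -/
def piFinSuccAddEquiv {n : ℕ} (M : Fin (n + 1) → Type) [∀ i, AddCommGroup (M i)] :
    ((i : Fin (n + 1)) → M i) ≃+ M 0 × ((i : Fin n) → M i.succ) :=
  { (Fin.consEquiv M).symm with map_add' := fun _ _ => rfl }

theorem exists_dvd_chain_insert {k : ℕ} (d : Fin k → ℕ) (hd : ∀ i, d i ≠ 0)
    (hchain : ∀ i j, i ≤ j → d i ∣ d j) (a : ℕ) (ha : a ≠ 0) :
    ∃ e : Fin (k + 1) → ℕ, (∀ i, e i ≠ 0) ∧ (∀ i j, i ≤ j → e i ∣ e j) ∧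
      (∀ c, c ∣ a → (∀ i, c ∣ d i) → ∀ i, c ∣ e i) ∧
      Nonempty (ZMod a × ((i : Fin k) → ZMod (d i)) ≃+ ((i : Fin (k + 1)) → ZMod (e i))) := by
  induction k generalizing a with
  | zero =>
    refine ⟨fun _ => a, fun _ => ha, fun _ _ _ => dvd_rfl, fun c hc _ _ => hc, ⟨?_⟩⟩
    exact AddEquiv.trans (AddEquiv.prodCongr (AddEquiv.refl _)
      { Equiv.ofUnique _ _ with map_add' := fun _ _ => Subsingleton.elim _ _ })
      (piFinSuccAddEquiv (fun _ : Fin 1 => ZMod a)).symm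
  | succ k ih =>
    obtain ⟨e, he0, hec, hed, ⟨φ⟩⟩ := ih (fun i => d i.succ) (fun i => hd _)
      (fun i j hij => hchain _ _ (by simpa using hij)) (Nat.lcm a (d 0))
      (Nat.lcm_ne_zero ha (hd 0))
    obtain ⟨ψ⟩ := nonempty_zmod_prod_addEquiv_gcd_lcm ha (hd 0)
    refine ⟨Fin.cons (Nat.gcd a (d 0)) e, ?_, ?_, ?_, ⟨?_⟩⟩
    · intro i
      refine Fin.cases ?_ (fun i => ?_) i
      · simpa using fun h => absurd h ha
      · simpa using he0 i
    · intro i j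
      refine Fin.cases ?_ (fun i => ?_) i <;> refine Fin.cases ?_ (fun j => ?_) j
      · simp
      · intro _
        simp only [Fin.cons_zero, Fin.cons_succ]
        exact hed _ ((Nat.gcd_dvd_left _ _).trans (Nat.dvd_lcm_left _ _))
          (fun i => (Nat.gcd_dvd_right _ _).trans (hchain _ _ (Fin.zero_le _))) j
      · intro h; simp at h
      · intro h
        simpa using hec i j (by simpa using h)
    · intro c hca hcd i
      refine Fin.cases ?_ (fun i => ?_) i
      · simpa using Nat.dvd_gcd hca (hcd 0)
      · simpa using hed c (hca.trans (Nat.dvd_lcm_left _ _)) (fun i => hcd _) i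
    · exact ((AddEquiv.refl _).prodCongr (piFinSuccAddEquiv fun i => ZMod (d i))).trans <|
        AddEquiv.prodAssoc.symm.trans <| (ψ.prodCongr (AddEquiv.refl _)).trans <|
        AddEquiv.prodAssoc.trans <| ((AddEquiv.refl _).prodCongr φ).trans
        (piFinSuccAddEquiv fun i =>
          ZMod ((Fin.cons (Nat.gcd a (d 0)) e : Fin (k + 1 + 1) → ℕ) i)).symm

theorem exists_dvd_chain_addEquiv {k : ℕ} (d : Fin k → ℕ) (hd : ∀ i, d i ≠ 0) :
    ∃ e : Fin k → ℕ, (∀ i, e i ≠ 0) ∧ (∀ i j, i ≤ j → e i ∣ e j) ∧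
      Nonempty (((i : Fin k) → ZMod (d i)) ≃+ ((i : Fin k) → ZMod (e i))) := by
  induction k with
  | zero => exact ⟨d, hd, fun i => i.elim0, ⟨AddEquiv.refl _⟩⟩
  | succ k ih =>
    obtain ⟨e, he0, hec, ⟨φ⟩⟩ := ih (fun i => d i.succ) (fun i => hd _)
    obtain ⟨f, hf0, hfc, -, ⟨ψ⟩⟩ := exists_dvd_chain_insert e he0 hec (d 0) (hd 0)
    exact ⟨f, hf0, hfc, ⟨(piFinSuccAddEquiv fun i => ZMod (d i)).trans <|
      ((AddEquiv.refl _).prodCongr φ).trans ψ⟩⟩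

theorem exists_dvd_chain_one_lt {k : ℕ} (d : Fin k → ℕ) (hd : ∀ i, d i ≠ 0)
    (hchain : ∀ i j, i ≤ j → d i ∣ d j) :
    ∃ (l : ℕ) (e : Fin l → ℕ), (∀ i, 1 < e i) ∧ (∀ i j, i ≤ j → e i ∣ e j) ∧
      Nonempty (((i : Fin k) → ZMod (d i)) ≃+ ((i : Fin l) → ZMod (e i))) := by
  induction k with
  | zero => exact ⟨0, d, fun i => i.elim0, fun i => i.elim0, ⟨AddEquiv.refl _⟩⟩
  | succ k ih =>
    by_cases h1 : d 0 = 1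
    · obtain ⟨l, e, he1, hec, ⟨φ⟩⟩ := ih (fun i => d i.succ) (fun i => hd _)
        (fun i j hij => hchain _ _ (by simpa using hij))
      have : Unique (ZMod (d 0)) := by rw [h1]; infer_instance
      exact ⟨l, e, he1, hec, ⟨(piFinSuccAddEquiv fun i => ZMod (d i)).trans <|
        AddEquiv.uniqueProd.trans φ⟩⟩
    · refine ⟨k + 1, d, fun i => ?_, hchain, ⟨AddEquiv.refl _⟩⟩
      have h2 := Nat.le_of_dvd (Nat.pos_of_ne_zero (hd i)) (hchain 0 i (Fin.zero_le _))
      have := hd 0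
      omega

theorem exists_invariant_factors (G : Type*) [CommGroup G] [Finite G] :
    ∃ (l : ℕ) (e : Fin l → ℕ), (∀ i, 1 < e i) ∧ (∀ i j, i ≤ j → e i ∣ e j) ∧
      Nonempty (G ≃* ((i : Fin l) → Multiplicative (ZMod (e i)))) := by
  obtain ⟨ι, _, n, hn, ⟨φ⟩⟩ := AddCommGroup.equiv_directSum_zmod_of_finite' (Additive G)
  let s := Fintype.equivFin ι
  obtain ⟨d, hd0, hdc, ⟨ψ⟩⟩ := exists_dvd_chain_addEquiv (fun i => n (s.symm i))
    (fun i => by have := hn (s.symm i); omega)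
  obtain ⟨l, e, he1, hec, ⟨χ⟩⟩ := exists_dvd_chain_one_lt d hd0 hdc
  refine ⟨l, e, he1, hec, ⟨MulEquiv.toAdditive.symm <| AddEquiv.trans ?_
    (MulEquiv.piMultiplicative _).toAdditiveRight⟩⟩
  exact φ.trans <| (DirectSum.addEquivProd _).trans <|
    (RingEquiv.piCongrLeft' (fun i => ZMod (n i)) s).toAddEquiv.trans <| ψ.trans χ

/-- Chebyshev's upper bound, with every prime power `Q` weighted by `log Q`. -/
theorem exists_sum_primePow_log_le : ∃ C : ℝ, 0 < C ∧ ∀ N : ℕ,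
    ∑ Q ∈ Ioc 0 N with IsPrimePow Q, Real.log Q ≤ C * N := by
  have hl2 : 0 < Real.log 2 := Real.log_pos (by norm_num)
  have hl4 : 0 < Real.log 4 := Real.log_pos (by norm_num)
  refine ⟨Real.log 4 + 32 / Real.log 2, by positivity, fun N => ?_⟩
  rcases Nat.eq_zero_or_pos N with rfl | hN
  · simp
  have hN1 : (1 : ℝ) ≤ N := by exact_mod_cast hN
  have hlN : 0 ≤ Real.log N := Real.log_nonneg hN1
  have hterm : ∀ Q ∈ Ioc 0 N, (if IsPrimePow Q then Real.log Q else 0) ≤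
      (if Q.Prime then Real.log Q else 0) + Real.log N / Real.log 2 *
        (ArithmeticFunction.vonMangoldt Q - if Q.Prime then Real.log Q else 0) := by
    intro Q hQ
    by_cases hp : Q.Prime
    · simp [hp, hp.isPrimePow, ArithmeticFunction.vonMangoldt_apply_prime hp]
    by_cases hpp : IsPrimePow Q
    · simp only [hpp, hp, if_true, if_false, zero_add, sub_zero,
        ArithmeticFunction.vonMangoldt_apply]
      have h1 : Real.log Q ≤ Real.log N := by
        apply Real.log_le_log
        · exact_mod_cast (mem_Ioc.1 hQ).1
        · exact_mod_cast (mem_Ioc.1 hQ).2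
      have h2 : Real.log 2 ≤ Real.log Q.minFac := by
        apply Real.log_le_log (by norm_num)
        exact_mod_cast (Nat.minFac_prime hpp.ne_one).two_le
      calc Real.log Q ≤ Real.log N / Real.log 2 * Real.log 2 := by
            rwa [div_mul_cancel₀ _ hl2.ne']
        _ ≤ _ := by gcongr
    · simp [hpp, hp, ArithmeticFunction.vonMangoldt_apply]
  have hψ := Chebyshev.abs_psi_sub_theta_le_sqrt_mul_log hN1
  have hθ := Chebyshev.theta_le_log4_mul_x (x := N) (by positivity)
  have hsum : ∑ Q ∈ Ioc 0 N with IsPrimePow Q, Real.log Q ≤ Chebyshev.theta N +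
      Real.log N / Real.log 2 * (Chebyshev.psi N - Chebyshev.theta N) := by
    rw [sum_filter]
    refine (sum_le_sum hterm).trans_eq ?_
    rw [sum_add_distrib, ← mul_sum, sum_sub_distrib]
    simp [Chebyshev.psi, Chebyshev.theta, sum_filter]
  have hlog : Real.log N ≤ 4 * (N : ℝ) ^ (1 / 4 : ℝ) := by
    have := Real.log_le_rpow_div (x := N) (by positivity) (show (0 : ℝ) < 1 / 4 by norm_num)
    linarith
  have hsq : Real.log N ^ 2 ≤ 16 * Real.sqrt N := by
    have h : ((N : ℝ) ^ (1 / 4 : ℝ)) ^ 2 = Real.sqrt N := by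
      rw [Real.sqrt_eq_rpow, ← Real.rpow_natCast, ← Real.rpow_mul (by positivity)]
      norm_num
    calc Real.log N ^ 2 ≤ (4 * (N : ℝ) ^ (1 / 4 : ℝ)) ^ 2 := by gcongr
      _ = 16 * Real.sqrt N := by rw [mul_pow, h]; norm_num
  have hss : Real.sqrt N * Real.sqrt N = N := Real.mul_self_sqrt (by positivity)
  calc _ ≤ _ := hsum
    _ ≤ Real.log 4 * N + Real.log N / Real.log 2 * (2 * Real.sqrt N * Real.log N) := by
        gcongr
        exact (le_abs_self _).trans hψ
    _ = Real.log 4 * N + 2 / Real.log 2 * Real.sqrt N * Real.log N ^ 2 := by ring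
    _ ≤ Real.log 4 * N + 2 / Real.log 2 * Real.sqrt N * (16 * Real.sqrt N) := by gcongr
    _ = Real.log 4 * N + 32 / Real.log 2 * (Real.sqrt N * Real.sqrt N) := by ring
    _ = _ := by rw [hss]; ring

/-- The reciprocal sum of the prime powers up to `2 ^ J` is at most a constant times the `J`-th
harmonic number. -/
theorem exists_sum_primePow_inv_two_pow_le : ∃ D : ℝ, 0 < D ∧ ∀ J : ℕ,
    ∑ Q ∈ Ioc 0 (2 ^ J : ℕ) with IsPrimePow Q, (Q : ℝ)⁻¹ ≤ D * (harmonic J : ℚ) := by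
  obtain ⟨C, hC, hsum⟩ := exists_sum_primePow_log_le
  have hl2 : 0 < Real.log 2 := Real.log_pos (by norm_num)
  refine ⟨4 * C / Real.log 2, by positivity, fun J => ?_⟩
  induction J with
  | zero =>
    have : ∑ Q ∈ Ioc 0 (2 ^ 0 : ℕ) with IsPrimePow Q, (Q : ℝ)⁻¹ = 0 := by
      refine sum_eq_zero fun Q hQ => ?_
      simp only [pow_zero, mem_filter, mem_Ioc] at hQ
      have := hQ.2.two_le
      omega
    rw [this]; simp
  | succ J ih =>
    have hsplit : ∑ Q ∈ Ioc 0 (2 ^ (J + 1) : ℕ) with IsPrimePow Q, (Q : ℝ)⁻¹ =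
        ∑ Q ∈ Ioc 0 (2 ^ J : ℕ) with IsPrimePow Q, (Q : ℝ)⁻¹ +
        ∑ Q ∈ Ioc (2 ^ J : ℕ) (2 ^ (J + 1)) with IsPrimePow Q, (Q : ℝ)⁻¹ := by
      simp only [sum_filter]
      exact (sum_Ioc_consecutive _ (Nat.zero_le _) (Nat.pow_le_pow_right (by norm_num)
        (Nat.le_succ J))).symm
    have hstep : ∑ Q ∈ Ioc (2 ^ J : ℕ) (2 ^ (J + 1)) with IsPrimePow Q, (Q : ℝ)⁻¹ ≤
        ∑ Q ∈ Ioc 0 (2 ^ (J + 1) : ℕ) with IsPrimePow Q,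
          2 / ((J + 1) * Real.log 2 * 2 ^ J) * Real.log Q := by
      refine (sum_le_sum fun Q hQ => ?_).trans
        (sum_le_sum_of_subset_of_nonneg (filter_subset_filter _
          (Ioc_subset_Ioc_left (Nat.zero_le _))) fun Q hQ _ => ?_)
      · simp only [mem_filter, mem_Ioc] at hQ
        have hQJ : (2 : ℝ) ^ J ≤ Q := by exact_mod_cast hQ.1.1.le
        have hQ2 : (2 : ℝ) ≤ Q := by exact_mod_cast hQ.2.two_le
        have h1 : J * Real.log 2 ≤ Real.log Q := by
          rw [← Real.log_pow]
          exact Real.log_le_log (by positivity) hQJ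
        have h2 : Real.log 2 ≤ Real.log Q := Real.log_le_log (by norm_num) hQ2
        have h3 : 1 ≤ 2 / ((J + 1) * Real.log 2) * Real.log Q := by
          rw [div_mul_eq_mul_div, one_le_div (by positivity)]
          linarith
        calc (Q : ℝ)⁻¹ ≤ (2 ^ J)⁻¹ := by gcongr
          _ ≤ (2 ^ J)⁻¹ * (2 / ((J + 1) * Real.log 2) * Real.log Q) :=
            le_mul_of_one_le_right (by positivity) h3
          _ = _ := by field_simp
      · have : 0 ≤ Real.log Q := Real.log_natCast_nonneg Q
        positivity
    rw [← mul_sum] at hstep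
    rw [hsplit, harmonic_succ]
    push_cast
    rw [mul_add]
    refine add_le_add ih (hstep.trans ?_)
    calc _ ≤ 2 / ((J + 1) * Real.log 2 * 2 ^ J) * (C * ((2 ^ (J + 1) : ℕ) : ℝ)) := by
          gcongr
          exact hsum _
      _ = _ := by
          push_cast
          field_simp
          ring

theorem exists_sum_primePow_inv_le : ∃ D : ℝ, 0 < D ∧ ∀ x : ℝ, Real.exp (Real.exp 1) ≤ x →
    ∑ Q ∈ Ioc 0 ⌊x⌋₊ with IsPrimePow Q, (Q : ℝ)⁻¹ ≤ D * Real.log (Real.log x) := by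
  obtain ⟨D, hD, hsum⟩ := exists_sum_primePow_inv_two_pow_le
  refine ⟨4 * D, by positivity, fun x hx => ?_⟩
  have hx0 : 0 < x := (Real.exp_pos _).trans_le hx
  have hlx : Real.exp 1 ≤ Real.log x := (Real.le_log_iff_exp_le hx0).2 hx
  have hlx0 : 0 < Real.log x := (Real.exp_pos _).trans_le hlx
  have hllx : 1 ≤ Real.log (Real.log x) := (Real.le_log_iff_exp_le hlx0).2 hlx
  have he : 2 ≤ Real.exp 1 := by linarith [Real.add_one_le_exp 1]
  set N := ⌊x⌋₊
  have hN : 1 ≤ N := (Nat.one_le_floor_iff _).2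
    ((Real.one_le_exp (Real.exp_pos _).le).trans hx)
  set J := Nat.log 2 N + 1
  have hNJ : N ≤ 2 ^ J := (Nat.lt_pow_succ_log_self (by norm_num) N).le
  have hJ : (J : ℝ) ≤ 3 * Real.log x := by
    have h1 : ((2 ^ Nat.log 2 N : ℕ) : ℝ) ≤ x :=
      (Nat.cast_le.2 (Nat.pow_log_le_self 2 (by omega))).trans (Nat.floor_le hx0.le)
    have h2 := Real.log_le_log (by positivity) h1
    push_cast at h2
    rw [Real.log_pow] at h2
    have := Real.log_two_gt_d9
    have h0 : (0 : ℝ) ≤ Nat.log 2 N := by positivity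
    have : (J : ℝ) = Nat.log 2 N + 1 := by simp [J]
    nlinarith
  have hlogJ : Real.log J ≤ 2 + Real.log (Real.log x) := by
    have h := Real.log_le_log (by positivity) hJ
    rw [Real.log_mul (by norm_num) hlx0.ne'] at h
    have := Real.log_le_sub_one_of_pos (show (0 : ℝ) < 3 by norm_num)
    linarith
  calc _ ≤ ∑ Q ∈ Ioc 0 (2 ^ J : ℕ) with IsPrimePow Q, (Q : ℝ)⁻¹ :=
        sum_le_sum_of_subset_of_nonneg (filter_subset_filter _ (Ioc_subset_Ioc_right hNJ))
          fun _ _ _ => by positivity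
    _ ≤ D * (harmonic J : ℚ) := hsum J
    _ ≤ D * (1 + Real.log J) := by gcongr; exact harmonic_le_one_add_log J
    _ ≤ D * (4 * Real.log (Real.log x)) := by gcongr; linarith
    _ = _ := by ring

theorem isPrimePow_ordProj {n p : ℕ} (hp : p ∈ n.primeFactors) : IsPrimePow (ordProj[p] n) :=
  (Nat.prime_of_mem_primeFactors hp).isPrimePow.pow
    ((Nat.prime_of_mem_primeFactors hp).factorization_pos_of_dvd
      (Nat.mem_primeFactors.1 hp).2.2 (Nat.dvd_of_mem_primeFactors hp)).ne'

theorem card_primeFactors_ordCompl_add_one {n p : ℕ} (hp : p ∈ n.primeFactors) :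
    (ordCompl[p] n).primeFactors.card + 1 = n.primeFactors.card := by
  rw [← Nat.support_factorization (n / _), Nat.factorization_ordCompl, Finsupp.support_erase,
    Nat.support_factorization, card_erase_add_one hp]

/-- The positive integers up to `N` with at most `k` distinct prime factors. -/
def fewPrimeFactors (k N : ℕ) : Finset ℕ := {n ∈ Ioc 0 N | n.primeFactors.card ≤ k}

theorem ordCompl_mem_fewPrimeFactors {k N n p : ℕ} (hn : n ∈ fewPrimeFactors (k + 1) N)
    (hp : p ∈ n.primeFactors) : ordCompl[p] n ∈ fewPrimeFactors k N := by
  simp only [fewPrimeFactors, mem_filter, mem_Ioc] at hn ⊢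
  have := card_primeFactors_ordCompl_add_one hp
  exact ⟨⟨Nat.ordCompl_pos p hn.1.1.ne', (Nat.ordCompl_le n p).trans hn.1.2⟩, by omega⟩

theorem sum_inv_fewPrimeFactors_le (k N : ℕ) :
    ∑ n ∈ fewPrimeFactors k N, (n : ℝ)⁻¹ ≤
      (1 + ∑ Q ∈ Ioc 0 N with IsPrimePow Q, (Q : ℝ)⁻¹) ^ k := by
  set P := ∑ Q ∈ Ioc 0 N with IsPrimePow Q, (Q : ℝ)⁻¹
  have hP : 0 ≤ P := sum_nonneg fun _ _ => by positivity
  induction k with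
  | zero =>
    have : fewPrimeFactors 0 N ⊆ {1} := by
      intro n hn
      simp only [fewPrimeFactors, mem_filter, mem_Ioc, Nat.le_zero, card_eq_zero,
        Nat.primeFactors_eq_empty] at hn
      simp; omega
    refine (sum_le_sum_of_subset_of_nonneg this fun _ _ _ => by positivity).trans ?_
    simp
  | succ k ih =>
    set W : Finset ℕ := (fewPrimeFactors k N ×ˢ {Q ∈ Ioc 0 N | IsPrimePow Q}).image
      fun t => t.2 * t.1 with hW
    have hsub : fewPrimeFactors (k + 1) N ⊆ insert 1 W := by
      intro n hn
      rcases eq_or_ne n 1 with rfl | h1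
      · simp
      refine mem_insert_of_mem (mem_image.2 ?_)
      have hnN := hn
      simp only [fewPrimeFactors, mem_filter, mem_Ioc] at hnN
      have hp : n.minFac ∈ n.primeFactors :=
        Nat.mem_primeFactors.2 ⟨Nat.minFac_prime h1, Nat.minFac_dvd n, hnN.1.1.ne'⟩
      refine ⟨(ordCompl[n.minFac] n, ordProj[n.minFac] n), mem_product.2
        ⟨ordCompl_mem_fewPrimeFactors hn hp, mem_filter.2 ⟨mem_Ioc.2 ⟨Nat.ordProj_pos _ _,
          (Nat.ordProj_le _ hnN.1.1.ne').trans hnN.1.2⟩, isPrimePow_ordProj hp⟩⟩,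
        Nat.ordProj_mul_ordCompl_eq_self _ _⟩
    have hS : 1 ≤ (1 + P) ^ k := one_le_pow₀ (by linarith)
    calc _ ≤ ∑ n ∈ insert 1 W, (n : ℝ)⁻¹ :=
          sum_le_sum_of_subset_of_nonneg hsub fun _ _ _ => by positivity
      _ ≤ 1 + ∑ n ∈ W, (n : ℝ)⁻¹ := by
          by_cases h : 1 ∈ W
          · rw [insert_eq_of_mem h]; linarith
          · rw [sum_insert h]; simp
      _ ≤ 1 + ∑ t ∈ fewPrimeFactors k N ×ˢ {Q ∈ Ioc 0 N | IsPrimePow Q},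
            ((t.2 * t.1 : ℕ) : ℝ)⁻¹ := by
          gcongr
          refine sum_image_le_of_nonneg (f := fun n : ℕ => (n : ℝ)⁻¹) ?_
          intros; positivity
      _ = 1 + (∑ n ∈ fewPrimeFactors k N, (n : ℝ)⁻¹) * P := by
          rw [sum_mul_sum, sum_product]
          simp [mul_comm]
      _ ≤ (1 + P) ^ k + (1 + P) ^ k * P := by gcongr
      _ = _ := by ring

theorem log_eq_sum_primeFactors {n : ℕ} (hn : n ≠ 0) :
    Real.log n = ∑ p ∈ n.primeFactors, Real.log (ordProj[p] n : ℕ) := by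
  rw [← Real.log_prod]
  · rw [← Nat.cast_prod]
    congr 2
    exact (Nat.prod_factorization_pow_eq_self hn).symm
  · intro p _
    exact_mod_cast (Nat.ordProj_pos n p).ne'

theorem sum_log_fewPrimeFactors_le {C : ℝ}
    (hC : ∀ N : ℕ, ∑ Q ∈ Ioc 0 N with IsPrimePow Q, Real.log Q ≤ C * N) (hC0 : 0 < C) (k N : ℕ) :
    ∑ n ∈ fewPrimeFactors (k + 1) N, Real.log n ≤
      C * N * ∑ m ∈ fewPrimeFactors k N, (m : ℝ)⁻¹ := by
  set T := (fewPrimeFactors (k + 1) N).sigma fun n => n.primeFactors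
  set U := (fewPrimeFactors k N).sigma fun m => {Q ∈ Ioc 0 (N / m) | IsPrimePow Q}
  let g : (Σ _ : ℕ, ℕ) → (Σ _ : ℕ, ℕ) := fun t => ⟨ordCompl[t.2] t.1, ordProj[t.2] t.1⟩
  have hg : Set.InjOn g T := by
    rintro ⟨n, p⟩ hn ⟨r, s⟩ hr h
    simp only [T, mem_coe, mem_sigma] at hn hr
    simp only [g, Sigma.mk.injEq, heq_eq_eq] at h
    have hnn : n = r := by
      rw [← Nat.ordProj_mul_ordCompl_eq_self n p, ← Nat.ordProj_mul_ordCompl_eq_self r s,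
        h.1, h.2]
    have hpp : p = s := by
      have h1 := (Nat.prime_of_mem_primeFactors hn.2)
      have h2 := (Nat.prime_of_mem_primeFactors hr.2)
      have e1 := h1.pow_minFac (h1.factorization_pos_of_dvd
        (Nat.mem_primeFactors.1 hn.2).2.2 (Nat.dvd_of_mem_primeFactors hn.2)).ne'
      have e2 := h2.pow_minFac (h2.factorization_pos_of_dvd
        (Nat.mem_primeFactors.1 hr.2).2.2 (Nat.dvd_of_mem_primeFactors hr.2)).ne'
      rw [← e1, ← e2, h.2]
    subst hnn hpp
    rfl
  have hsub : T.image g ⊆ U := by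
    intro t ht
    obtain ⟨⟨n, p⟩, hn, rfl⟩ := mem_image.1 ht
    simp only [T, mem_sigma] at hn
    have hm := ordCompl_mem_fewPrimeFactors hn.1 hn.2
    have hnN := (mem_Ioc.1 (mem_filter.1 hn.1).1).2
    refine mem_sigma.2 ⟨hm, mem_filter.2 ⟨mem_Ioc.2 ⟨Nat.ordProj_pos _ _, ?_⟩,
      isPrimePow_ordProj hn.2⟩⟩
    refine (Nat.le_div_iff_mul_le (mem_Ioc.1 (mem_filter.1 hm).1).1).2 ?_
    exact (Nat.ordProj_mul_ordCompl_eq_self n p).le.trans hnN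
  calc ∑ n ∈ fewPrimeFactors (k + 1) N, Real.log n
      = ∑ t ∈ T, Real.log (g t).2 := by
        rw [sum_sigma]
        refine sum_congr rfl fun n hn => ?_
        exact log_eq_sum_primeFactors (mem_Ioc.1 (mem_filter.1 hn).1).1.ne'
    _ = ∑ t ∈ T.image g, Real.log t.2 := (sum_image (f := fun t => Real.log t.2) hg).symm
    _ ≤ ∑ t ∈ U, Real.log t.2 :=
        sum_le_sum_of_subset_of_nonneg hsub fun t _ _ => Real.log_natCast_nonneg _
    _ = ∑ m ∈ fewPrimeFactors k N, ∑ Q ∈ Ioc 0 (N / m) with IsPrimePow Q, Real.log Q :=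
        sum_sigma _ _ _
    _ ≤ ∑ m ∈ fewPrimeFactors k N, C * N * (m : ℝ)⁻¹ := by
        refine sum_le_sum fun m _ => (hC _).trans ?_
        rw [mul_assoc, ← div_eq_mul_inv]
        gcongr
        exact Nat.cast_div_le
    _ = _ := (mul_sum _ _ _).symm

/-- Landau's upper bound for the number of integers with a bounded number of prime factors. -/
theorem exists_card_fewPrimeFactors_le (b : ℕ) (hb : 1 ≤ b) : ∃ C : ℝ, 0 < C ∧
    ∀ x : ℝ, Real.exp (Real.exp 1) ≤ x → ((fewPrimeFactors b ⌊x⌋₊).card : ℝ) ≤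
      C * (x * Real.log (Real.log x) ^ (b - 1) / Real.log x) := by
  obtain ⟨k, rfl⟩ := Nat.exists_eq_add_of_le' hb
  obtain ⟨C, hC, hsum⟩ := exists_sum_primePow_log_le
  obtain ⟨D, hD, hinv⟩ := exists_sum_primePow_inv_le
  refine ⟨2 + 2 * C * (1 + D) ^ k, by positivity, fun x hx => ?_⟩
  rw [Nat.add_sub_cancel]
  have hx0 : 0 < x := (Real.exp_pos _).trans_le hx
  have hlx : Real.exp 1 ≤ Real.log x := (Real.le_log_iff_exp_le hx0).2 hx
  have hlx0 : 0 < Real.log x := (Real.exp_pos _).trans_le hlx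
  have hllx : 1 ≤ Real.log (Real.log x) := (Real.le_log_iff_exp_le hlx0).2 hlx
  set N := ⌊x⌋₊
  set LL := Real.log (Real.log x)
  have hNx : (N : ℝ) ≤ x := Nat.floor_le hx0.le
  have hlogs : ∑ n ∈ fewPrimeFactors (k + 1) N, Real.log n ≤ C * x * ((1 + D) * LL) ^ k := by
    refine (sum_log_fewPrimeFactors_le hsum hC k N).trans ?_
    gcongr
    refine (sum_inv_fewPrimeFactors_le k N).trans ?_
    have := hinv x hx
    have h0 : 0 ≤ ∑ Q ∈ Ioc 0 N with IsPrimePow Q, (Q : ℝ)⁻¹ :=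
      sum_nonneg fun _ _ => by positivity
    gcongr
    linarith
  have hterm : ∀ n ∈ fewPrimeFactors (k + 1) N, (1 : ℝ) ≤
      (if n ∈ Ioc 0 ⌊Real.sqrt x⌋₊ then 1 else 0) + 2 / Real.log x * Real.log n := by
    intro n hn
    have hn0 := (mem_Ioc.1 (mem_filter.1 hn).1).1
    have hln : 0 ≤ Real.log n := Real.log_natCast_nonneg n
    split_ifs with h
    · have : 0 ≤ 2 / Real.log x * Real.log n := by positivity
      linarith
    · have h1 : Real.sqrt x ≤ n := by
        have : ⌊Real.sqrt x⌋₊ < n := by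
          simp only [mem_Ioc, not_and, not_le] at h
          exact h hn0
        exact ((Nat.floor_lt (Real.sqrt_nonneg _)).1 this).le
      have h2 := Real.log_le_log (Real.sqrt_pos.2 hx0) h1
      rw [Real.log_sqrt hx0.le] at h2
      rw [zero_add, div_mul_eq_mul_div, one_le_div hlx0]
      linarith
  have hcard : ((fewPrimeFactors (k + 1) N).card : ℝ) ≤
      Real.sqrt x + 2 / Real.log x * (C * x * ((1 + D) * LL) ^ k) := by
    calc ((fewPrimeFactors (k + 1) N).card : ℝ) = ∑ n ∈ fewPrimeFactors (k + 1) N, (1 : ℝ) := by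
          simp
      _ ≤ _ := sum_le_sum hterm
      _ = ((fewPrimeFactors (k + 1) N ∩ Ioc 0 ⌊Real.sqrt x⌋₊).card : ℝ) +
          2 / Real.log x * ∑ n ∈ fewPrimeFactors (k + 1) N, Real.log n := by
          rw [sum_add_distrib, ← mul_sum, sum_ite_mem]
          simp
      _ ≤ _ := by
          gcongr
          have h1 : (fewPrimeFactors (k + 1) N ∩ Ioc 0 ⌊Real.sqrt x⌋₊).card ≤ ⌊Real.sqrt x⌋₊ :=
            (card_le_card inter_subset_right).trans (by simp)
          exact (Nat.cast_le.2 h1).trans (Nat.floor_le (Real.sqrt_nonneg _))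
  have hsqrt : Real.sqrt x ≤ 2 * (x * LL ^ k / Real.log x) := by
    have h1 : Real.log x ≤ 2 * Real.sqrt x := by
      have := Real.log_le_sub_one_of_pos (Real.sqrt_pos.2 hx0)
      rw [Real.log_sqrt hx0.le] at this
      linarith
    have h2 : (1 : ℝ) ≤ LL ^ k := one_le_pow₀ hllx
    have h3 : Real.sqrt x * Real.sqrt x = x := Real.mul_self_sqrt hx0.le
    rw [mul_div_assoc', le_div_iff₀ hlx0]
    calc Real.sqrt x * Real.log x ≤ Real.sqrt x * (2 * Real.sqrt x) := by gcongr
      _ = 2 * (x * 1) := by linear_combination 2 * h3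
      _ ≤ _ := by gcongr
  refine hcard.trans ?_
  have : 2 / Real.log x * (C * x * ((1 + D) * LL) ^ k) =
      2 * C * (1 + D) ^ k * (x * LL ^ k / Real.log x) := by
    rw [mul_pow]; ring
  rw [this, add_mul]
  gcongr

theorem lambda1_ne_zero (n : ℕ) : lambda1 n ≠ 0 := by
  unfold lambda1
  split_ifs with hn
  · exact one_ne_zero
  push Not at hn
  have : NeZero n := ⟨by omega⟩
  have hset : {m | ∃ (k : ℕ) (d : Fin (k + 1) → ℕ),
      IsInvFactorDecomp (ZMod n)ˣ d ∧ d 0 = m}.Nonempty := by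
    obtain ⟨l, e, he1, hec, ⟨φ⟩⟩ := exists_invariant_factors (ZMod n)ˣ
    cases l with
    | zero =>
      have h1 : Nat.card (ZMod n)ˣ = 1 := (Nat.card_congr φ.toEquiv).trans (by simp)
      rw [Nat.card_eq_fintype_card, ZMod.card_units_eq_totient] at h1
      have := Nat.totient_eq_one_iff.1 h1
      omega
    | succ k => exact ⟨e 0, k, e, ⟨he1, hec, ⟨φ⟩⟩, rfl⟩
  obtain ⟨k, d, hd, h0⟩ := Nat.sInf_mem hset
  have := hd.1 0
  unfold leastInvFactor
  omega

theorem Ecount_eq_card (q : ℕ) (x : ℝ) :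
    Ecount q x = #{n ∈ Ioc 0 ⌊x⌋₊ | lambda1 n = q} := by
  rw [Ecount, ← Set.ncard_coe_finset]
  congr 1
  ext n
  by_cases hn : n = 0 <;> simp [hn, Nat.le_floor_iff', and_assoc]

theorem Dcount_eq_card (q : ℕ) (x : ℝ) :
    Dcount q x = #{n ∈ Ioc 0 ⌊x⌋₊ | q ∣ lambda1 n} := by
  rw [Dcount, ← Set.ncard_coe_finset]
  congr 1
  ext n
  by_cases hn : n = 0 <;> simp [hn, Nat.le_floor_iff', and_assoc]

theorem Dstar_eq_card (q : ℕ) (x : ℝ) (b : ℕ) :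
    Dstar q x b = #{n ∈ Ioc 0 ⌊x⌋₊ | q ∣ lambda1 n ∧ b < n.primeFactors.card} := by
  rw [Dstar, ← Set.ncard_coe_finset]
  congr 1
  ext n
  by_cases hn : n = 0 <;> simp [hn, Nat.le_floor_iff', and_assoc]

theorem exists_Dstar_mul_eq_zero {q : ℕ} (hq : 0 < q) (x : ℝ) (b : ℕ) :
    ∃ K, (∀ n ∈ Ioc 0 ⌊x⌋₊, lambda1 n < K) ∧ ∀ m, K ≤ m → Dstar (m * q) x b = 0 := by
  have hK : ∀ n ∈ Ioc 0 ⌊x⌋₊, lambda1 n < (Ioc 0 ⌊x⌋₊).sup lambda1 + 1 :=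
    fun n hn => Nat.lt_succ_of_le (le_sup hn)
  refine ⟨_, hK, fun m hm => ?_⟩
  rw [Dstar_eq_card, card_eq_zero, filter_eq_empty_iff]
  rintro n hn ⟨hdvd, -⟩
  have h1 := Nat.le_of_dvd (Nat.pos_of_ne_zero (lambda1_ne_zero n)) hdvd
  have h2 := hK n hn
  have h3 := Nat.le_mul_of_pos_right m hq
  omega

theorem Dcount_le_add {q M b : ℕ} (x : ℝ) {K : ℕ} (hK : ∀ n ∈ Ioc 0 ⌊x⌋₊, lambda1 n < K)
    (hq : 0 < q) : Dcount q x ≤ Ecount q x + (∑ m ∈ Ico 2 M, Dcount (m * q) x +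
      ∑ m ∈ Ico M K, Dstar (m * q) x b + #(fewPrimeFactors b ⌊x⌋₊)) := by
  simp only [Ecount_eq_card, Dcount_eq_card, Dstar_eq_card]
  have hsub : {n ∈ Ioc 0 ⌊x⌋₊ | q ∣ lambda1 n} ⊆ {n ∈ Ioc 0 ⌊x⌋₊ | lambda1 n = q} ∪
      (((Ico 2 M).biUnion fun m => {n ∈ Ioc 0 ⌊x⌋₊ | m * q ∣ lambda1 n}) ∪
      ((Ico M K).biUnion fun m => {n ∈ Ioc 0 ⌊x⌋₊ | m * q ∣ lambda1 n ∧
        b < n.primeFactors.card}) ∪ fewPrimeFactors b ⌊x⌋₊) := by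
    intro n hn
    obtain ⟨hnx, m, hm⟩ := mem_filter.1 hn
    rw [mul_comm] at hm
    have hm0 : m ≠ 0 := by
      rintro rfl
      exact lambda1_ne_zero n (by simpa using hm)
    have hmK : m < K := lt_of_le_of_lt (by rw [hm]; exact Nat.le_mul_of_pos_right m hq) (hK n hnx)
    simp only [mem_union, mem_biUnion, mem_filter, mem_Ico, fewPrimeFactors]
    rcases eq_or_ne m 1 with rfl | hm1
    · exact Or.inl ⟨hnx, by simpa using hm⟩
    right
    by_cases hmM : m < M
    · exact Or.inl (Or.inl ⟨m, ⟨by omega, hmM⟩, hnx, hm ▸ dvd_rfl⟩)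
    by_cases hω : b < n.primeFactors.card
    · exact Or.inl (Or.inr ⟨m, ⟨by omega, hmK⟩, hnx, hm ▸ dvd_rfl, hω⟩)
    · exact Or.inr ⟨hnx, by omega⟩
  refine (card_le_card hsub).trans <| (card_union_le _ _).trans ?_
  gcongr
  refine (card_union_le _ _).trans ?_
  gcongr
  refine (card_union_le _ _).trans ?_
  gcongr <;> exact card_biUnion_le

theorem Ecount_le_Dcount (q : ℕ) (x : ℝ) : Ecount q x ≤ Dcount q x := by
  rw [Ecount_eq_card, Dcount_eq_card]
  exact card_le_card (monotone_filter_right _ fun n _ h => h ▸ dvd_rfl)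

theorem stmt14 (b : ℕ) (hb : 4 ≤ b) : ∃ Cb : ℝ, 0 < Cb ∧
    ∀ (q M : ℕ), 4 ≤ q → 4 ≤ M → ∀ x : ℝ, Real.exp (Real.exp 1) ≤ x →
      |(Ecount q x : ℝ) - (Dcount q x : ℝ)| ≤
        Cb * ((∑ m ∈ Finset.Ico 2 M, (Dcount (m * q) x : ℝ)) +
          (∑' m : ℕ, if M ≤ m then (Dstar (m * q) x b : ℝ) else 0) +
          M * x * Real.log (Real.log x) ^ (b - 1) / Real.log x) := by
  obtain ⟨C, hC, hcard⟩ := exists_card_fewPrimeFactors_le b (by omega)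
  refine ⟨1 + C, by positivity, fun q M hq hM x hx => ?_⟩
  have hq0 : 0 < q := by omega
  obtain ⟨K, hK, hvanish⟩ := exists_Dstar_mul_eq_zero hq0 x b
  have hx0 : 0 < x := (Real.exp_pos _).trans_le hx
  have hlx : Real.exp 1 ≤ Real.log x := (Real.le_log_iff_exp_le hx0).2 hx
  have hlx0 : 0 < Real.log x := (Real.exp_pos _).trans_le hlx
  have hllx : 1 ≤ Real.log (Real.log x) := (Real.le_log_iff_exp_le hlx0).2 hlx
  have htsum : ∑' m : ℕ, (if M ≤ m then (Dstar (m * q) x b : ℝ) else 0) =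
      ∑ m ∈ Ico M K, (Dstar (m * q) x b : ℝ) := by
    rw [tsum_eq_sum (s := Ico M K)]
    · exact sum_congr rfl fun m hm => if_pos (mem_Ico.1 hm).1
    · intro m hm
      split_ifs with h
      · rw [hvanish m (by simp only [mem_Ico, not_and, not_lt] at hm; exact hm h), Nat.cast_zero]
      · rfl
  have hle : (Dcount q x : ℝ) ≤ Ecount q x + (∑ m ∈ Ico 2 M, (Dcount (m * q) x : ℝ) +
      ∑ m ∈ Ico M K, (Dstar (m * q) x b : ℝ) + #(fewPrimeFactors b ⌊x⌋₊)) := by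
    exact_mod_cast Dcount_le_add (M := M) (b := b) x hK hq0
  have hED : (Ecount q x : ℝ) ≤ Dcount q x := by exact_mod_cast Ecount_le_Dcount q x
  rw [htsum, abs_sub_comm, abs_of_nonneg (sub_nonneg.2 hED)]
  set S₁ := ∑ m ∈ Ico 2 M, (Dcount (m * q) x : ℝ)
  set S₂ := ∑ m ∈ Ico M K, (Dstar (m * q) x b : ℝ)
  set T := x * Real.log (Real.log x) ^ (b - 1) / Real.log x with hT
  have hS₁ : 0 ≤ S₁ := sum_nonneg fun _ _ => by positivity
  have hS₂ : 0 ≤ S₂ := sum_nonneg fun _ _ => by positivity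
  have hT0 : 0 ≤ T := by positivity
  have hMT : M * x * Real.log (Real.log x) ^ (b - 1) / Real.log x = M * T := by rw [hT]; ring
  have hM1 : (1 : ℝ) ≤ M := by exact_mod_cast (by omega : 1 ≤ M)
  rw [hMT]
  calc (Dcount q x : ℝ) - Ecount q x ≤ S₁ + S₂ + C * T := by linarith [hcard x hx]
    _ ≤ (1 + C) * (S₁ + S₂) + (1 + C) * (1 * T) := by
        nlinarith [mul_nonneg hC.le hS₁, mul_nonneg hC.le hS₂]
    _ ≤ (1 + C) * (S₁ + S₂) + (1 + C) * (M * T) := by gcongr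
    _ = _ := by ring
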